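/- Let A, B, C ∈ B(H) be such that |A|B = B*|A| and |A*|C = C*|A*|. Then the numerical radius satisfies w(C*AB) ≤ (1/8) · (‖B‖ + ‖B²‖^{1/2}) · (‖C‖ + ‖C²‖^{1/2}) · (‖A‖ + ‖A²‖^{1/2}); equivalently, for every unit vector x ∈ H, |⟨C*ABx, x⟩| is bounded by this quantity. -/

import Mathlib

open scoped InnerProductSpace
open ContinuousLinearMap

/-- The absolute value `|A| = (A^*A)^{1/2}` of a bounded operator, via the
continuous functional calculus. -/
noncomputable def oabs {H : Type*} [NormedAddCommGroup H] [InnerProductSpace ℂ H]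
    [CompleteSpace H] (A : H →L[ℂ] H) : H →L[ℂ] H :=
  cfc Real.sqrt (adjoint A * A)

theorem aux_seq (f : ℕ → ℝ) (M c : ℝ) (hc : 0 ≤ c) (h0 : ∀ m, 0 ≤ f m)
    (h2 : ∀ m, f m ^ 2 ≤ f 0 * f (2 * m)) (hM : ∀ m, f m ≤ M * c ^ m) : f 1 ≤ c * f 0 := by
  have key : ∀ k : ℕ, f 1 ^ (2 ^ k) * f 0 ≤ f 0 ^ (2 ^ k) * f (2 ^ k) := by
    intro k
    induction k with
    | zero => simp [mul_comm]
    | succ k ih =>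
      rcases (h0 0).eq_or_lt with h | h
      · rw [← h]; simp
      have h3 := h2 (2 ^ k)
      rw [← pow_succ'] at h3
      have h4 : (f 1 ^ (2 ^ k) * f 0) ^ 2 ≤ (f 0 ^ (2 ^ k) * f (2 ^ k)) ^ 2 :=
        pow_le_pow_left₀ (mul_nonneg (pow_nonneg (h0 _) _) (h0 _)) ih 2
      have h5 : (f 0 ^ (2 ^ k) * f (2 ^ k)) ^ 2 ≤ (f 0 ^ (2 ^ k)) ^ 2 * (f 0 * f (2 ^ (k + 1))) := by
        rw [mul_pow]
        exact mul_le_mul_of_nonneg_left h3 (sq_nonneg _)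
      rw [pow_succ 2 k, pow_mul, pow_mul, ← pow_succ]
      refine le_of_mul_le_mul_right ?_ h
      nlinarith [h4, h5]
  by_contra! hlt
  rcases (h0 0).eq_or_lt with h | h
  · have := h2 1
    rw [← h] at this hlt
    nlinarith
  rcases hc.eq_or_lt with h' | h'
  · have := hM 1
    rw [← h'] at this hlt
    simp at this hlt
    linarith
  have hcf : 0 < c * f 0 := mul_pos h' h
  have hr : 0 < f 1 / (c * f 0) - 1 := by
    rw [sub_pos, lt_div_iff₀ hcf]; linarith
  obtain ⟨n, hn⟩ := exists_nat_gt (M / f 0 / (f 1 / (c * f 0) - 1))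
  have hb := one_add_mul_le_pow (a := f 1 / (c * f 0) - 1) (by linarith) (2 ^ n)
  have h6 : (f 1 / (c * f 0)) ^ (2 ^ n) ≤ M / f 0 := by
    rw [div_pow, div_le_div_iff₀ (pow_pos hcf _) h]
    calc _ ≤ _ := key n
      _ ≤ f 0 ^ (2 ^ n) * (M * c ^ (2 ^ n)) :=
        mul_le_mul_of_nonneg_left (hM _) (pow_nonneg h.le _)
      _ = _ := by rw [mul_pow]; ring
  rw [div_lt_iff₀ hr] at hn
  have h7 : (n : ℝ) ≤ ((2 ^ n : ℕ) : ℝ) := by exact_mod_cast Nat.lt_two_pow_self.le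
  have h8 := mul_le_mul_of_nonneg_right h7 hr.le
  rw [add_sub_cancel] at hb
  linarith

section
variable {H : Type*} [NormedAddCommGroup H] [InnerProductSpace ℂ H] [CompleteSpace H]

theorem aux_root (P : H →L[ℂ] H) (h : 0 ≤ P) :
    ∃ R : H →L[ℂ] H, adjoint R = R ∧ R * R = P :=
  ⟨CFC.sqrt P, (CFC.sqrt_nonneg P).isSelfAdjoint, CFC.sqrt_mul_sqrt_self P h⟩

theorem aux_self (y : H) : ‖⟪y, y⟫_ℂ‖ = ‖y‖ ^ 2 := by
  rw [inner_self_eq_norm_sq_to_K]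
  simp

theorem aux_inner (R : H →L[ℂ] H) (hR : adjoint R = R) (x y : H) :
    ⟪(R * R) x, y⟫_ℂ = ⟪R x, R y⟫_ℂ := by
  rw [mul_apply_eq_comp, ← adjoint_inner_right, hR]

theorem aux_pow (P D : H →L[ℂ] H) (h : P * D = adjoint D * P) (m : ℕ) :
    P * D ^ m = adjoint (D ^ m) * P := by
  rw [← star_eq_adjoint] at *
  rw [star_pow]
  exact (show SemiconjBy P D (star D) from h).pow_right m

/-- `a_m ^ 2 ≤ a_0 a_{2m}` -/
theorem aux_sq (R D : H →L[ℂ] H) (hR : adjoint R = R)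
    (h : R * R * D = adjoint D * (R * R)) (x : H) :
    ‖R (D x)‖ ^ 2 ≤ ‖R x‖ * ‖R ((D * D) x)‖ := by
  have e : ⟪R (D x), R (D x)⟫_ℂ = ⟪R x, R ((D * D) x)⟫_ℂ := by
    rw [← aux_inner R hR, ← aux_inner R hR]
    have : (R * R) (D x) = adjoint D ((R * R) x) := by
      simpa using congrArg (fun T : H →L[ℂ] H => T x) h
    rw [this, adjoint_inner_left]
    rfl
  have := norm_inner_le_norm (𝕜 := ℂ) (R x) (R ((D * D) x))
  rw [← e, aux_self] at this
  exact this

theorem aux_reid (R D : H →L[ℂ] H) (hR : adjoint R = R)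
    (h : R * R * D = adjoint D * (R * R)) (x : H) :
    ‖R (D x)‖ ≤ ‖D‖ * ‖R x‖ := by
  have := aux_seq (fun m => ‖R ((D ^ m) x)‖) (‖R‖ * ‖x‖) ‖D‖ (norm_nonneg _)
    (fun m => norm_nonneg _) ?_ ?_
  · simpa using this
  · intro m
    have := aux_sq R (D ^ m) hR (aux_pow _ _ h m) x
    simpa [two_mul, pow_add] using this
  · intro m
    have h1 : ‖(D ^ m) x‖ ≤ ‖D‖ ^ m * ‖x‖ := by
      induction m with
      | zero => simp
      | succ m ih =>
        rw [pow_succ', pow_succ', mul_apply_eq_comp, mul_assoc]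
        exact (D.le_opNorm _).trans (mul_le_mul_of_nonneg_left ih (norm_nonneg _))
    calc _ ≤ ‖R‖ * ‖(D ^ m) x‖ := R.le_opNorm _
      _ ≤ ‖R‖ * (‖D‖ ^ m * ‖x‖) := mul_le_mul_of_nonneg_left h1 (norm_nonneg _)
      _ = _ := by ring

theorem aux_reid2 (R B : H →L[ℂ] H) (hR : adjoint R = R)
    (h : R * R * B = adjoint B * (R * R)) (x : H) :
    ‖R (B x)‖ ≤ Real.sqrt ‖B ^ 2‖ * ‖R x‖ := by
  have h1 := aux_sq R B hR h x
  have h2 := aux_reid R (B ^ 2) hR (aux_pow _ _ h 2) x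
  rw [← pow_two] at h1
  refine le_of_sq_le_sq ?_ (by positivity)
  rw [mul_pow, Real.sq_sqrt (norm_nonneg _)]
  nlinarith [norm_nonneg (R x)]

theorem oabs_nonneg (A : H →L[ℂ] H) : 0 ≤ oabs A :=
  cfc_nonneg fun x _ => Real.sqrt_nonneg x

theorem oabs_adj (A : H →L[ℂ] H) : adjoint (oabs A) = oabs A :=
  (oabs_nonneg A).isSelfAdjoint

theorem oabs_mul_self (A : H →L[ℂ] H) : oabs A * oabs A = adjoint A * A := by
  have hs : 0 ≤ adjoint A * A := star_mul_self_nonneg A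
  unfold oabs
  rw [← cfc_mul Real.sqrt Real.sqrt (adjoint A * A)
    Real.continuous_sqrt.continuousOn Real.continuous_sqrt.continuousOn]
  conv_rhs => rw [← cfc_id ℝ (adjoint A * A) hs.isSelfAdjoint]
  apply cfc_congr
  intro x hx
  exact Real.mul_self_sqrt (spectrum_nonneg_of_nonneg hs hx)

theorem norm_oabs_apply (A : H →L[ℂ] H) (x : H) : ‖oabs A x‖ = ‖A x‖ := by
  have h : ⟪oabs A x, oabs A x⟫_ℂ = ⟪A x, A x⟫_ℂ := by
    rw [← aux_inner _ (oabs_adj A), oabs_mul_self, mul_apply_eq_comp, adjoint_inner_left]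
  rw [inner_self_eq_norm_sq_to_K, inner_self_eq_norm_sq_to_K] at h
  have h' : ‖oabs A x‖ ^ 2 = ‖A x‖ ^ 2 := by exact_mod_cast h
  exact (sq_eq_sq₀ (norm_nonneg _) (norm_nonneg _)).1 h'

theorem aux_poly (A : H →L[ℂ] H) (p : Polynomial ℝ) :
    A * Polynomial.aeval (adjoint A * A) p = Polynomial.aeval (A * adjoint A) p * A := by
  induction p using Polynomial.induction_on' with
  | add p q hp hq => simp only [map_add, mul_add, add_mul, hp, hq]
  | monomial n r =>
    simp only [Polynomial.aeval_monomial]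
    have : A * (adjoint A * A) ^ n = (A * adjoint A) ^ n * A :=
      (show SemiconjBy A (adjoint A * A) (A * adjoint A) from (mul_assoc _ _ _).symm).pow_right n
    rw [← mul_assoc, ← Algebra.commutes, mul_assoc, this, mul_assoc]

theorem aux_approx (a : H →L[ℂ] H) (ha : IsSelfAdjoint a) (p : Polynomial ℝ) (ε r : ℝ) (hε : 0 ≤ ε)
    (hr : ‖a‖ * ‖(1 : H →L[ℂ] H)‖ ≤ r)
    (hp : ∀ x ∈ Set.Icc (-r) r, |Polynomial.eval x p - Real.sqrt x| < ε) :
    ‖Polynomial.aeval a p - cfc Real.sqrt a‖ ≤ ε := by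
  rw [← cfc_polynomial p a ha, ← cfc_sub (fun x => Polynomial.eval x p) Real.sqrt a
    p.continuous.continuousOn Real.continuous_sqrt.continuousOn]
  refine norm_cfc_le hε fun x hx => ?_
  have := (spectrum.norm_le_norm_mul_of_mem hx).trans hr
  exact (hp x (abs_le.1 this)).le

theorem aux_intertwine (A : H →L[ℂ] H) : A * oabs A = oabs (adjoint A) * A := by
  rw [← sub_eq_zero, ← norm_le_zero_iff]
  refine le_of_forall_pos_le_add fun ε hε => ?_
  have h1 : IsSelfAdjoint (adjoint A * A) := IsSelfAdjoint.star_mul_self A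
  have h2 : IsSelfAdjoint (A * adjoint A) := IsSelfAdjoint.mul_star_self A
  set r := max (‖adjoint A * A‖ * ‖(1 : H →L[ℂ] H)‖) (‖A * adjoint A‖ * ‖(1 : H →L[ℂ] H)‖)
  set η := ε / (2 * (‖A‖ + 1)) with hη
  have hη0 : 0 < η := by positivity
  obtain ⟨p, hp⟩ := exists_polynomial_near_of_continuousOn (-r) r Real.sqrt
    Real.continuous_sqrt.continuousOn η hη0
  have e1 := aux_approx _ h1 p η r hη0.le (le_max_left _ _) hp
  have e2 := aux_approx _ h2 p η r hη0.le (le_max_right _ _) hp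
  have e : A * oabs A - oabs (adjoint A) * A =
      (Polynomial.aeval (A * adjoint A) p - cfc Real.sqrt (A * adjoint A)) * A
      - A * (Polynomial.aeval (adjoint A * A) p - cfc Real.sqrt (adjoint A * A)) := by
    rw [sub_mul, mul_sub, aux_poly]
    simp only [oabs, adjoint_adjoint]
    abel
  rw [e]
  calc _ ≤ _ := norm_sub_le _ _
    _ ≤ η * ‖A‖ + ‖A‖ * η := add_le_add
        ((norm_mul_le _ _).trans (mul_le_mul_of_nonneg_right e2 (norm_nonneg _)))
        ((norm_mul_le _ _).trans (mul_le_mul_of_nonneg_left e1 (norm_nonneg _)))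
    _ ≤ η * (2 * (‖A‖ + 1)) := by nlinarith
    _ = 0 + ε := by rw [hη, zero_add]; field_simp

theorem aux_schwarz (A R S : H →L[ℂ] H) (hR : adjoint R = R) (hS : adjoint S = S)
    (hRR : R * R = oabs A) (hSS : S * S = oabs (adjoint A)) (u v : H) :
    ‖⟪A u, v⟫_ℂ‖ ≤ ‖R u‖ * ‖S v‖ := by
  set P := oabs A with hP
  -- on the range of `P`
  have hran : ∀ w, ‖⟪A (P w), v⟫_ℂ‖ ≤ ‖R (P w)‖ * ‖S v‖ := by
    intro w
    have e1 : A (P w) = (S * S) (A w) := by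
      rw [hSS]
      exact congrArg (fun T : H →L[ℂ] H => T w) (aux_intertwine A)
    have e2 : ‖S (A w)‖ = ‖R (P w)‖ := by
      have : ⟪S (A w), S (A w)⟫_ℂ = ⟪R (P w), R (P w)⟫_ℂ := by
        rw [← aux_inner S hS, ← aux_inner R hR, hRR, ← e1, ← adjoint_inner_right,
          ← mul_apply_eq_comp (adjoint A) A, ← oabs_mul_self, mul_apply_eq_comp,
          ← adjoint_inner_left, ← hP, hP, oabs_adj]
      rw [inner_self_eq_norm_sq_to_K, inner_self_eq_norm_sq_to_K] at this
      have h' : ‖S (A w)‖ ^ 2 = ‖R (P w)‖ ^ 2 := by exact_mod_cast this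
      exact (sq_eq_sq₀ (norm_nonneg _) (norm_nonneg _)).1 h'
    rw [e1, aux_inner S hS, ← e2]
    exact norm_inner_le_norm _ _
  obtain ⟨y, hy, z, hz, rfl⟩ :=
    Submodule.exists_add_mem_mem_orthogonal (K := (LinearMap.range P.toLinearMap).topologicalClosure) u
  have hPz : P z = 0 := by
    rw [← inner_self_eq_zero (𝕜 := ℂ)]
    have := hz (P (P z)) (Submodule.le_topologicalClosure _ ⟨P z, rfl⟩)
    rw [← adjoint_inner_left, hP, oabs_adj]
    exact this
  have hAz : A z = 0 := by
    rw [← norm_eq_zero, ← norm_oabs_apply, ← hP, hPz, norm_zero]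
  have hRz : R z = 0 := by
    rw [← inner_self_eq_zero (𝕜 := ℂ), ← aux_inner R hR, hRR, hPz, inner_zero_left]
  rw [map_add, map_add, hAz, hRz, add_zero, add_zero]
  have hcl : IsClosed {y : H | ‖⟪A y, v⟫_ℂ‖ ≤ ‖R y‖ * ‖S v‖} :=
    isClosed_le (by fun_prop) (by fun_prop)
  have : closure (Set.range P) ⊆ {y : H | ‖⟪A y, v⟫_ℂ‖ ≤ ‖R y‖ * ‖S v‖} := by
    refine closure_minimal ?_ hcl
    rintro _ ⟨w, rfl⟩
    exact hran w
  apply this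
  have h3 : y ∈ closure ((LinearMap.range P.toLinearMap : Submodule ℂ H) : Set H) := hy
  rw [LinearMap.coe_range] at h3
  exact h3

theorem aux_norm_le (A : H →L[ℂ] H) : ‖oabs A‖ = ‖A‖ :=
  le_antisymm (opNorm_le_bound _ (norm_nonneg _) fun x => norm_oabs_apply A x ▸ A.le_opNorm x)
    (opNorm_le_bound _ (norm_nonneg _) fun x => norm_oabs_apply A x ▸ (oabs A).le_opNorm x)

theorem aux_norm_root (R P : H →L[ℂ] H) (hR : adjoint R = R) (h : R * R = P) :
    ‖R‖ ^ 2 = ‖P‖ := by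
  have := CStarRing.norm_star_mul_self (x := R)
  rw [star_eq_adjoint, hR, h] at this
  rw [this, pow_two]

theorem norm_oabs_mul (A T : H →L[ℂ] H) : ‖oabs A * T‖ ≤ ‖A * T‖ := by
  refine opNorm_le_bound _ (norm_nonneg _) fun x => ?_
  rw [mul_apply_eq_comp, norm_oabs_apply]
  exact (A * T).le_opNorm x

theorem aux_PQ (A : H →L[ℂ] H) : ‖oabs A * oabs (adjoint A)‖ ≤ ‖A ^ 2‖ := by
  calc _ ≤ ‖A * oabs (adjoint A)‖ := norm_oabs_mul _ _
    _ = ‖oabs (adjoint A) * adjoint A‖ := by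
      rw [← norm_star, star_mul, star_eq_adjoint, star_eq_adjoint, oabs_adj]
    _ ≤ ‖adjoint A * adjoint A‖ := norm_oabs_mul _ _
    _ = ‖A ^ 2‖ := by
      rw [← norm_star (A ^ 2), star_pow, star_eq_adjoint, pow_two]

theorem aux_sum (A R S : H →L[ℂ] H) (hR : adjoint R = R) (hS : adjoint S = S)
    (hRR : R * R = oabs A) (hSS : S * S = oabs (adjoint A)) (x : H) (hx : ‖x‖ = 1) :
    ‖R x‖ ^ 2 + ‖S x‖ ^ 2 ≤ ‖A‖ + Real.sqrt ‖A ^ 2‖ := by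
  set P := oabs A with hP
  set Q := oabs (adjoint A) with hQ
  set δ := Real.sqrt ‖A ^ 2‖ with hδ
  have hδ0 : 0 ≤ δ := Real.sqrt_nonneg _
  have hδ2 : δ ^ 2 = ‖A ^ 2‖ := Real.sq_sqrt (norm_nonneg _)
  have hPa : adjoint P = P := oabs_adj A
  have hQa : adjoint Q = Q := oabs_adj (adjoint A)
  have nR : ‖R‖ ^ 2 = ‖A‖ := by rw [aux_norm_root R P hR hRR, hP, aux_norm_le]
  have nS : ‖S‖ ^ 2 = ‖A‖ := by
    rw [aux_norm_root S Q hS hSS, hQ, aux_norm_le, ← star_eq_adjoint, norm_star]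
  have hPx : ‖P x‖ ^ 2 ≤ ‖A‖ * ‖R x‖ ^ 2 := by
    rw [← nR, ← mul_pow, ← hRR]
    exact pow_le_pow_left₀ (norm_nonneg _) (R.le_opNorm _) 2
  have hQx : ‖Q x‖ ^ 2 ≤ ‖A‖ * ‖S x‖ ^ 2 := by
    rw [← nS, ← mul_pow, ← hSS]
    exact pow_le_pow_left₀ (norm_nonneg _) (S.le_opNorm _) 2
  -- `‖R Q x‖ ≤ δ ‖S x‖`
  have hRQ : ‖R (Q x)‖ ≤ δ * ‖S x‖ := by
    have h1 := aux_reid S (P * Q) hS (by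
      rw [hSS, ← star_eq_adjoint, star_mul, star_eq_adjoint, star_eq_adjoint, hPa, hQa, mul_assoc]) x
    have h2 : ⟪R (Q x), R (Q x)⟫_ℂ = ⟪S ((P * Q) x), S x⟫_ℂ := by
      rw [← aux_inner R hR, ← aux_inner S hS, hRR, hSS, mul_apply_eq_comp,
        ← adjoint_inner_right Q, hQa]
    have h3 := norm_inner_le_norm (𝕜 := ℂ) (S ((P * Q) x)) (S x)
    rw [← h2, aux_self] at h3
    have h4 : ‖P * Q‖ ≤ δ ^ 2 := hδ2 ▸ aux_PQ A
    refine le_of_sq_le_sq ?_ (by positivity)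
    calc _ ≤ _ := h3
      _ ≤ (δ ^ 2 * ‖S x‖) * ‖S x‖ := by gcongr; exact h1.trans (by gcongr)
      _ = _ := by ring
  have hcross : ‖⟪P x, Q x⟫_ℂ‖ ≤ ‖R x‖ * (δ * ‖S x‖) := by
    rw [← hRR, aux_inner R hR]
    exact (norm_inner_le_norm _ _).trans (by gcongr)
  have hs : ‖P x + Q x‖ ^ 2 ≤ (‖A‖ + δ) * (‖R x‖ ^ 2 + ‖S x‖ ^ 2) := by
    rw [norm_add_sq (𝕜 := ℂ)]
    have h1 : RCLike.re ⟪P x, Q x⟫_ℂ ≤ ‖⟪P x, Q x⟫_ℂ‖ := RCLike.re_le_norm _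
    nlinarith [mul_nonneg hδ0 (sq_nonneg (‖R x‖ - ‖S x‖))]
  have hl : ‖R x‖ ^ 2 + ‖S x‖ ^ 2 ≤ ‖P x + Q x‖ := by
    have e : ⟪P x + Q x, x⟫_ℂ = ((‖R x‖ ^ 2 + ‖S x‖ ^ 2 : ℝ) : ℂ) := by
      rw [inner_add_left, ← hRR, ← hSS, aux_inner R hR, aux_inner S hS,
        inner_self_eq_norm_sq_to_K, inner_self_eq_norm_sq_to_K]
      push_cast
      rfl
    have h1 := norm_inner_le_norm (𝕜 := ℂ) (P x + Q x) x
    rw [e, hx, mul_one, Complex.norm_real, Real.norm_of_nonneg (by positivity)] at h1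
    exact h1
  by_contra! hlt
  have hpos : 0 ≤ ‖A‖ + δ := by positivity
  nlinarith [norm_nonneg (P x + Q x)]

theorem aux_half (B : H →L[ℂ] H) : Real.sqrt ‖B ^ 2‖ ≤ 1 / 2 * (‖B‖ + Real.sqrt ‖B ^ 2‖) := by
  have : Real.sqrt ‖B ^ 2‖ ≤ ‖B‖ := by
    rw [Real.sqrt_le_left (norm_nonneg _), pow_two, pow_two]
    exact norm_mul_le _ _
  linarith

end

theorem stmt15 {H : Type*} [NormedAddCommGroup H] [InnerProductSpace ℂ H] [CompleteSpace H]
    (A B C : H →L[ℂ] H)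
    (hAB : oabs A * B = adjoint B * oabs A)
    (hAC : oabs (adjoint A) * C = adjoint C * oabs (adjoint A))
    (x : H) (hx : ‖x‖ = 1) :
    ‖⟪(adjoint C * A * B) x, x⟫_ℂ‖ ≤
      1 / 8 * (‖B‖ + Real.sqrt ‖B ^ 2‖) * (‖C‖ + Real.sqrt ‖C ^ 2‖) *
        (‖A‖ + Real.sqrt ‖A ^ 2‖) := by
  obtain ⟨R, hR, hRR⟩ := aux_root _ (oabs_nonneg A)
  obtain ⟨S, hS, hSS⟩ := aux_root _ (oabs_nonneg (adjoint A))
  have e : ⟪(adjoint C * A * B) x, x⟫_ℂ = ⟪A (B x), C x⟫_ℂ := by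
    simp only [mul_apply_eq_comp, adjoint_inner_left]
  rw [e]
  have h1 := aux_schwarz A R S hR hS hRR hSS (B x) (C x)
  have h2 := aux_reid2 R B hR (by rw [hRR]; exact hAB) x
  have h3 := aux_reid2 S C hS (by rw [hSS]; exact hAC) x
  have h4 := aux_sum A R S hR hS hRR hSS x hx
  have h2' := h2.trans (mul_le_mul_of_nonneg_right (aux_half B) (norm_nonneg _))
  have h3' := h3.trans (mul_le_mul_of_nonneg_right (aux_half C) (norm_nonneg _))
  have h5 : ‖R x‖ * ‖S x‖ ≤ 1 / 2 * (‖A‖ + Real.sqrt ‖A ^ 2‖) := by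
    nlinarith [sq_nonneg (‖R x‖ - ‖S x‖)]
  set b := ‖B‖ + Real.sqrt ‖B ^ 2‖ with hb
  set c := ‖C‖ + Real.sqrt ‖C ^ 2‖ with hc
  have hb0 : 0 ≤ b := by positivity
  have hc0 : 0 ≤ c := by positivity
  calc _ ≤ _ := h1
    _ ≤ (1 / 2 * b * ‖R x‖) * (1 / 2 * c * ‖S x‖) :=
      mul_le_mul h2' h3' (norm_nonneg _) (by positivity)
    _ = (1 / 4 * b * c) * (‖R x‖ * ‖S x‖) := by ring
    _ ≤ (1 / 4 * b * c) * (1 / 2 * (‖A‖ + Real.sqrt ‖A ^ 2‖)) :=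
      mul_le_mul_of_nonneg_left h5 (by positivity)
    _ = _ := by ring
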